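/- Let G be a finite pseudoreflection subgroup of GL(n,ℂ), d = |G|, and let p₁,…,p_d be a basis of ℂ[z] as a module over ℂ[z]^G. Then for every entire function f : ℂⁿ → ℂ there exist unique G-invariant entire functions f₁,…,f_d : ℂⁿ → ℂ such that f(z) = Σᵢ₌₁^d pᵢ(z)fᵢ(z) for all z ∈ ℂⁿ. -/

import Mathlib

open MvPolynomial

noncomputable section

/-- The natural action of an invertible matrix on `ℂⁿ` by matrix-vector multiplication. -/
def gAct {n : ℕ} (σ : GL (Fin n) ℂ) (z : Fin n → ℂ) : Fin n → ℂ :=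
  Matrix.mulVec (σ : Matrix (Fin n) (Fin n) ℂ) z

/-- A pseudoreflection: an element of finite order in `GL(n,ℂ)` with `rank (1 - ρ) = 1`. -/
def IsPseudoreflection {n : ℕ} (ρ : GL (Fin n) ℂ) : Prop :=
  IsOfFinOrder ρ ∧ Matrix.rank ((1 : Matrix (Fin n) (Fin n) ℂ) - (ρ : Matrix (Fin n) (Fin n) ℂ)) = 1

/-- A subgroup of `GL(n,ℂ)` is a pseudoreflection group if it is generated by the
pseudoreflections it contains. -/
def IsPseudoreflectionGroup {n : ℕ} (G : Subgroup (GL (Fin n) ℂ)) : Prop :=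
  Subgroup.closure {ρ : GL (Fin n) ℂ | ρ ∈ G ∧ IsPseudoreflection ρ} = G

/-- The action of `σ ∈ GL(n,ℂ)` on polynomials: `(σ·p)(z) = p(σ⁻¹z)`. -/
def polyAct {n : ℕ} (σ : GL (Fin n) ℂ) (p : MvPolynomial (Fin n) ℂ) : MvPolynomial (Fin n) ℂ :=
  MvPolynomial.aeval
    (fun i => ∑ j, MvPolynomial.C (((σ⁻¹ : GL (Fin n) ℂ) : Matrix (Fin n) (Fin n) ℂ) i j)
      * MvPolynomial.X j) p

/-- The polynomial map `θ : ℂⁿ → ℂⁿ` associated to a tuple of polynomials. -/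
def polyMap {n : ℕ} (θ : Fin n → MvPolynomial (Fin n) ℂ) (z : Fin n → ℂ) : Fin n → ℂ :=
  fun i => MvPolynomial.eval z (θ i)

lemma sum_pow_mul_inv_pow_of_isPrimitiveRoot {N : ℕ} {ζ : ℂ} (hζ : IsPrimitiveRoot ζ N)
    {k m : ℕ} (hk : k < N) (hm : m < N) :
    ∑ j ∈ Finset.range N, (ζ ^ j) ^ k * ((ζ ^ j) ^ m)⁻¹ = if k = m then (N : ℂ) else 0 := by
  have hζ0 : ζ ≠ 0 := hζ.ne_zero (by omega)
  have hterm : ∀ j, (ζ ^ j) ^ k * ((ζ ^ j) ^ m)⁻¹ = (ζ ^ k * (ζ ^ m)⁻¹) ^ j := by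
    intro j
    rw [mul_pow, inv_pow, ← pow_mul, ← pow_mul, ← pow_mul, ← pow_mul, mul_comm j k, mul_comm j m]
  simp only [hterm]
  split_ifs with h
  · subst h
    simp [hζ0]
  · have hne : ζ ^ k * (ζ ^ m)⁻¹ ≠ 1 := by
      intro h1
      rw [mul_inv_eq_one₀ (pow_ne_zero _ hζ0)] at h1
      exact h (hζ.pow_inj hk hm h1)
    have hN : (ζ ^ k * (ζ ^ m)⁻¹) ^ N = 1 := by
      rw [mul_pow, inv_pow, ← pow_mul, ← pow_mul, mul_comm k, mul_comm m, pow_mul, pow_mul,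
        hζ.pow_eq_one]
      simp
    have := mul_geom_sum (ζ ^ k * (ζ ^ m)⁻¹) N
    rw [hN, sub_self] at this
    exact (mul_eq_zero.mp this).resolve_left (sub_ne_zero.mpr hne)

/-- The polynomial weight attached to a node `w` when interpolating at `N` equidistributed
nodes on a circle. -/
def circleWeight (N : ℕ) (w t : ℂ) : ℂ :=
  (N : ℂ)⁻¹ * ∑ m ∈ Finset.range N, (w⁻¹ * t) ^ m

lemma norm_circleWeight_le {N : ℕ} {R : ℝ} (hR : 0 < R) {w t : ℂ} (hw : ‖w‖ = R) (ht : ‖t‖ ≤ R) :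
    ‖circleWeight N w t‖ ≤ 1 := by
  have h1 : ‖w⁻¹ * t‖ ≤ 1 := by
    rw [norm_mul, norm_inv, hw, inv_mul_le_iff₀ hR]
    simpa using ht
  have h2 : ‖∑ m ∈ Finset.range N, (w⁻¹ * t) ^ m‖ ≤ N := by
    refine (norm_sum_le_of_le (f := fun m => (w⁻¹ * t) ^ m) (n := fun _ => (1 : ℝ)) _
      fun m _ => ?_).trans (by simp)
    rw [norm_pow]
    exact pow_le_one₀ (norm_nonneg _) h1
  rw [circleWeight, norm_mul, norm_inv, Complex.norm_natCast]
  rcases Nat.eq_zero_or_pos N with rfl | hN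
  · simp
  · rw [inv_mul_le_iff₀ (by exact_mod_cast hN)]
    simpa using h2

lemma sum_pow_mul_circleWeight {N : ℕ} {ζ : ℂ} (hζ : IsPrimitiveRoot ζ N) {r : ℂ} (hr : r ≠ 0)
    {k : ℕ} (hk : k < N) (t : ℂ) :
    ∑ j ∈ Finset.range N, (r * ζ ^ j) ^ k * circleWeight N (r * ζ ^ j) t = t ^ k := by
  have hN : (N : ℂ) ≠ 0 := by
    have : N ≠ 0 := by omega
    exact_mod_cast this
  calc ∑ j ∈ Finset.range N, (r * ζ ^ j) ^ k * circleWeight N (r * ζ ^ j) t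
      = ∑ j ∈ Finset.range N, ∑ m ∈ Finset.range N,
          ((N : ℂ)⁻¹ * r ^ k * (r⁻¹ * t) ^ m) * ((ζ ^ j) ^ k * ((ζ ^ j) ^ m)⁻¹) := by
        refine Finset.sum_congr rfl fun j _ => ?_
        rw [circleWeight, Finset.mul_sum, Finset.mul_sum]
        refine Finset.sum_congr rfl fun m _ => ?_
        rw [mul_inv]
        simp only [mul_pow, inv_pow]
        ring
    _ = ∑ m ∈ Finset.range N, ((N : ℂ)⁻¹ * r ^ k * (r⁻¹ * t) ^ m) *
          (if k = m then (N : ℂ) else 0) := by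
        rw [Finset.sum_comm]
        refine Finset.sum_congr rfl fun m hm => ?_
        rw [← Finset.mul_sum,
          sum_pow_mul_inv_pow_of_isPrimitiveRoot hζ hk (Finset.mem_range.mp hm)]
    _ = t ^ k := by
        simp only [mul_ite, mul_zero, Finset.sum_ite_eq, Finset.mem_range, hk, if_true]
        rw [mul_pow, inv_pow]
        field_simp

lemma norm_sub_sum_circleWeight_le {R : ℝ} (hR : 0 < R) {N : ℕ} {ζ : ℂ}
    (hζ : IsPrimitiveRoot ζ N) (hN : N ≠ 0) {M : ℝ} {h : ℂ → ℂ} (hh : Differentiable ℂ h)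
    (hM : ∀ t, ‖t‖ ≤ 4 * R → ‖h t‖ ≤ M) {t : ℂ} (ht : ‖t‖ ≤ R) :
    ‖h t - ∑ j ∈ Finset.range N, h (R * ζ ^ j) * circleWeight N (R * ζ ^ j) t‖
      ≤ 2 * (1 + N) * M / 2 ^ N := by
  have hM0 : 0 ≤ M := (norm_nonneg _).trans (hM 0 (by simp; positivity))
  have hnζ : ‖ζ‖ = 1 := hζ.norm'_eq_one hN
  have hw : ∀ j : ℕ, ‖(R : ℂ) * ζ ^ j‖ = R := by
    intro j
    simp [hnζ, abs_of_pos hR]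
  set c : ℕ → ℂ := fun k => (k.factorial : ℂ)⁻¹ * iteratedDeriv k h 0 with hc
  have hcb : ∀ k, ‖c k‖ ≤ M / (4 * R) ^ k := by
    intro k
    have := Complex.norm_iteratedDeriv_le_of_forall_mem_sphere_norm_le (c := 0) (R := 4 * R)
      (C := M) (f := h) k (by positivity) hh.diffContOnCl
      (fun z hz => hM z (by simpa using (mem_sphere_zero_iff_norm.mp hz).le))
    rw [hc]
    simp only [norm_mul, norm_inv, Complex.norm_natCast]
    rw [inv_mul_le_iff₀ (by positivity)]
    calc _ ≤ _ := this
      _ = _ := by ring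
  have hsum : ∀ s : ℂ, HasSum (fun k => c k * s ^ k) (h s) := by
    intro s
    have := Complex.hasSum_taylorSeries_of_entire hh 0 s
    refine (funext fun k => ?_ : (fun k => c k * s ^ k) = _) ▸ this
    simp only [hc, sub_zero, smul_eq_mul]
    ring
  have hS : HasSum (fun k => c k * (t ^ k - ∑ j ∈ Finset.range N,
      ((R : ℂ) * ζ ^ j) ^ k * circleWeight N (R * ζ ^ j) t))
      (h t - ∑ j ∈ Finset.range N, h (R * ζ ^ j) * circleWeight N (R * ζ ^ j) t) := by
    have h2 := (hsum t).sub (hasSum_sum fun j (_ : j ∈ Finset.range N) =>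
      (hsum (R * ζ ^ j)).mul_right (circleWeight N (R * ζ ^ j) t))
    simpa only [mul_sub, Finset.mul_sum, mul_assoc] using h2
  have hgeo : HasSum (fun k : ℕ => ((1 + N) * M / 2 ^ N) * (1 / 2 : ℝ) ^ k)
      (((1 + N) * M / 2 ^ N) * 2) := hasSum_geometric_two.mul_left _
  have hb : ∀ k, ‖c k * (t ^ k - ∑ j ∈ Finset.range N,
      ((R : ℂ) * ζ ^ j) ^ k * circleWeight N (R * ζ ^ j) t)‖ ≤
      ((1 + N) * M / 2 ^ N) * (1 / 2 : ℝ) ^ k := by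
    intro k
    rcases lt_or_ge k N with hk | hk
    · rw [sum_pow_mul_circleWeight hζ (by exact_mod_cast hR.ne') hk, sub_self, mul_zero, norm_zero]
      positivity
    · have h1 : ‖t ^ k - ∑ j ∈ Finset.range N,
          ((R : ℂ) * ζ ^ j) ^ k * circleWeight N (R * ζ ^ j) t‖ ≤ (1 + N) * R ^ k := by
        refine (norm_sub_le _ _).trans ?_
        have h3 : ‖t ^ k‖ ≤ R ^ k := by
          rw [norm_pow]
          gcongr
        have h4 : ‖∑ j ∈ Finset.range N,
            ((R : ℂ) * ζ ^ j) ^ k * circleWeight N (R * ζ ^ j) t‖ ≤ N * R ^ k := by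
          refine (norm_sum_le_of_le (n := fun _ => R ^ k) _ fun j _ => ?_).trans (by simp)
          rw [norm_mul, norm_pow, hw]
          exact mul_le_of_le_one_right (by positivity) (norm_circleWeight_le hR (hw j) ht)
        linarith
      rw [norm_mul]
      calc _ ≤ M / (4 * R) ^ k * ((1 + N) * R ^ k) := by gcongr; exact hcb k
        _ = (1 + N) * M / 2 ^ k * (1 / 2 : ℝ) ^ k := by
          have : (4 : ℝ) ^ k = 2 ^ k * 2 ^ k := by rw [← mul_pow]; norm_num
          rw [mul_pow, this, one_div, inv_pow]
          field_simp
        _ ≤ _ := by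
          gcongr
          norm_num
  calc _ = ‖∑' k, c k * (t ^ k - ∑ j ∈ Finset.range N,
      ((R : ℂ) * ζ ^ j) ^ k * circleWeight N (R * ζ ^ j) t)‖ := by rw [hS.tsum_eq]
    _ ≤ _ := tsum_of_norm_bounded hgeo hb
    _ = _ := by ring

/-- Entire functions are approximated by polynomials, uniformly on bounded sets. -/
theorem exists_mvPolynomial_near {n : ℕ} {f : (Fin n → ℂ) → ℂ} (hf : Differentiable ℂ f)
    {R : ℝ} (hR : 0 < R) {ε : ℝ} (hε : 0 < ε) :
    ∃ P : MvPolynomial (Fin n) ℂ, ∀ z, ‖z‖ ≤ R → ‖f z - eval z P‖ ≤ ε := by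
  induction n generalizing ε with
  | zero =>
    refine ⟨C (f 0), fun z _ => ?_⟩
    rw [Subsingleton.elim z 0]
    simpa using hε.le
  | succ n ih =>
    obtain ⟨M, hM⟩ := (isCompact_closedBall (0 : Fin (n + 1) → ℂ) (4 * R)).exists_bound_of_continuousOn
      hf.continuous.continuousOn
    have hlim : Filter.Tendsto (fun N : ℕ => 2 * (1 + N) * M / 2 ^ N) Filter.atTop (nhds 0) := by
      have h1 := tendsto_pow_const_div_const_pow_of_one_lt 1 (one_lt_two : (1 : ℝ) < 2)
      have h0 := tendsto_pow_const_div_const_pow_of_one_lt 0 (one_lt_two : (1 : ℝ) < 2)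
      have := (h0.add h1).const_mul (2 * M)
      simp only [add_zero, mul_zero] at this
      refine this.congr fun N => ?_
      ring
    obtain ⟨N, hN1, hN⟩ := ((hlim.eventually_le_const (half_pos hε)).and
      (Filter.eventually_gt_atTop 0)).exists
    have hζ := Complex.isPrimitiveRoot_exp N hN.ne'
    set ζ := Complex.exp (2 * Real.pi * Complex.I / N)
    have hnζ : ‖ζ‖ = 1 := hζ.norm'_eq_one hN.ne'
    have hw : ∀ j : ℕ, ‖(R : ℂ) * ζ ^ j‖ = R := by
      intro j
      simp [hnζ, abs_of_pos hR]
    have hN' : (0 : ℝ) < N := by exact_mod_cast hN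
    have hP : ∀ j : ℕ, ∃ P : MvPolynomial (Fin n) ℂ, ∀ z, ‖z‖ ≤ R →
        ‖f (Fin.cons (R * ζ ^ j) z) - eval z P‖ ≤ ε / (2 * N) := by
      intro j
      refine ih (f := fun z => f (Fin.cons (R * ζ ^ j) z)) (hf.comp ?_) (by positivity)
      rw [differentiable_pi]
      refine Fin.cases ?_ ?_
      · simp
      · intro i
        simp only [Fin.cons_succ]
        fun_prop
    choose P hP using hP
    refine ⟨∑ j ∈ Finset.range N, rename Fin.succ (P j) * (C (N : ℂ)⁻¹ *
      ∑ m ∈ Finset.range N, (C ((R : ℂ) * ζ ^ j)⁻¹ * X 0) ^ m), fun z hz => ?_⟩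
    have hz0 : ‖z 0‖ ≤ R := (norm_le_pi_norm z 0).trans hz
    have hzt : ‖Fin.tail z‖ ≤ R :=
      (pi_norm_le_iff_of_nonneg hR.le).mpr fun i => (norm_le_pi_norm z i.succ).trans hz
    have heval : eval z (∑ j ∈ Finset.range N, rename Fin.succ (P j) * (C (N : ℂ)⁻¹ *
        ∑ m ∈ Finset.range N, (C ((R : ℂ) * ζ ^ j)⁻¹ * X 0) ^ m)) =
        ∑ j ∈ Finset.range N, eval (Fin.tail z) (P j) * circleWeight N (R * ζ ^ j) (z 0) := by
      simp only [map_sum, map_mul, eval_rename, eval_C, map_pow, eval_X, circleWeight]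
      rfl
    have h1 : ‖f z - ∑ j ∈ Finset.range N,
        f (Fin.cons (R * ζ ^ j) (Fin.tail z)) * circleWeight N (R * ζ ^ j) (z 0)‖ ≤ ε / 2 := by
      have := norm_sub_sum_circleWeight_le hR hζ hN.ne' (M := M)
        (h := fun t => f (Fin.cons t (Fin.tail z))) (hf.comp ?_) (fun t ht => hM _ ?_) hz0
      · simp only [Fin.cons_self_tail] at this
        exact this.trans hN1
      · rw [differentiable_pi]
        refine Fin.cases ?_ ?_
        · simp only [Fin.cons_zero]
          fun_prop
        · simp
      · rw [mem_closedBall_zero_iff, pi_norm_le_iff_of_nonneg (by positivity)]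
        refine Fin.cases ?_ ?_
        · simpa using ht
        · intro i
          simp only [Fin.cons_succ]
          exact (norm_le_pi_norm _ i).trans (hzt.trans (by linarith))
    have h2 : ‖∑ j ∈ Finset.range N, (f (Fin.cons (R * ζ ^ j) (Fin.tail z)) -
        eval (Fin.tail z) (P j)) * circleWeight N (R * ζ ^ j) (z 0)‖ ≤ ε / 2 := by
      refine (norm_sum_le_of_le (n := fun _ => ε / (2 * N)) _ fun j _ => ?_).trans (le_of_eq ?_)
      · rw [norm_mul]
        exact (mul_le_of_le_one_right (norm_nonneg _) (norm_circleWeight_le hR (hw j) hz0)).trans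
          (hP j _ hzt)
      · simp only [Finset.sum_const, Finset.card_range, nsmul_eq_mul]
        field_simp
    rw [heval]
    simp only [sub_mul, Finset.sum_sub_distrib] at h2
    calc _ = _ := by rw [← sub_add_sub_cancel]
      _ ≤ _ := (norm_add_le _ _).trans (add_le_add h1 h2)
      _ = ε := by ring

/-- Restricted to suitable parallel lines, a nonzero polynomial has constant leading coefficient. -/
lemma exists_direction_coeff_eq {n : ℕ} {Q : MvPolynomial (Fin n) ℂ} (hQ : Q ≠ 0) :
    ∃ (v : Fin n → ℂ) (m : ℕ) (c : ℂ), c ≠ 0 ∧ ∀ z : Fin n → ℂ, ∃ P : Polynomial ℂ,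
      P.natDegree ≤ m ∧ P.coeff m = c ∧ ∀ t, P.eval t = eval (z + t • v) Q := by
  have hcomp : homogeneousComponent Q.totalDegree Q ≠ 0 := by
    obtain ⟨s, hs, hsd⟩ := Finset.exists_mem_eq_sup Q.support (support_nonempty.mpr hQ)
      (fun s => s.sum fun _ e => e)
    refine ne_zero_iff.mpr ⟨s, ?_⟩
    rw [coeff_homogeneousComponent, if_pos]
    · exact mem_support_iff.mp hs
    · exact hsd.symm
  obtain ⟨v, hv⟩ : ∃ v, eval v (homogeneousComponent Q.totalDegree Q) ≠ 0 := by
    by_contra! h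
    exact hcomp (MvPolynomial.funext fun v => by simpa using h v)
  refine ⟨v, Q.totalDegree, _, hv, fun z => ?_⟩
  set L : Fin n → Polynomial ℂ := fun i => Polynomial.C (z i) + Polynomial.C (v i) * Polynomial.X
    with hL
  have hLdeg : ∀ i, (L i).natDegree ≤ 1 := fun i => by
    simp only [hL]
    compute_degree
  have hLcoeff : ∀ i, (L i).coeff 1 = v i := fun i => by
    simp [hL, Polynomial.coeff_C]
  have hmdeg : ∀ s : Fin n →₀ ℕ, (∏ i, L i ^ s i).natDegree ≤ s.degree := by
    intro s
    refine (Polynomial.natDegree_prod_le _ _).trans ?_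
    rw [Finsupp.degree_eq_sum]
    refine Finset.sum_le_sum fun i _ => ?_
    simpa using Polynomial.natDegree_pow_le_of_le (s i) (hLdeg i)
  have hmcoeff : ∀ s : Fin n →₀ ℕ, (∏ i, L i ^ s i).coeff s.degree = ∏ i, v i ^ s i := by
    intro s
    rw [Finsupp.degree_eq_sum]
    have : ∀ T : Finset (Fin n), (∏ i ∈ T, L i ^ s i).natDegree ≤ ∑ i ∈ T, s i ∧
        (∏ i ∈ T, L i ^ s i).coeff (∑ i ∈ T, s i) = ∏ i ∈ T, v i ^ s i := by
      intro T
      induction T using Finset.induction_on with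
      | empty => simp
      | insert a T ha ih =>
        have hd : (L a ^ s a).natDegree ≤ s a := by
          simpa using Polynomial.natDegree_pow_le_of_le (s a) (hLdeg a)
        rw [Finset.prod_insert ha, Finset.sum_insert ha, Finset.prod_insert ha]
        refine ⟨Polynomial.natDegree_mul_le_of_le hd ih.1, ?_⟩
        rw [Polynomial.coeff_mul_add_eq_of_natDegree_le hd ih.1, ih.2]
        have := Polynomial.coeff_pow_of_natDegree_le (m := s a) (hLdeg a)
        rw [mul_one] at this
        rw [this, hLcoeff]
    exact (this Finset.univ).2
  have hexp : aeval L Q = ∑ s ∈ Q.support, Polynomial.C (coeff s Q) * ∏ i, L i ^ s i := by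
    rw [aeval_def, eval₂_eq']
    rfl
  refine ⟨aeval L Q, ?_, ?_, fun t => ?_⟩
  · rw [hexp]
    refine Polynomial.natDegree_sum_le_of_forall_le _ _ fun s hs => ?_
    exact (Polynomial.natDegree_C_mul_le _ _).trans ((hmdeg s).trans (le_totalDegree hs))
  · rw [hexp, Polynomial.finsetSum_coeff, homogeneousComponent_apply, map_sum, Finset.sum_filter]
    refine Finset.sum_congr rfl fun s hs => ?_
    rw [Polynomial.coeff_C_mul]
    split_ifs with h
    · rw [← h, hmcoeff, eval_monomial, Finsupp.prod_fintype _ _ (by simp)]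
    · rw [Polynomial.coeff_eq_zero_of_natDegree_lt, mul_zero]
      exact (hmdeg s).trans_lt (lt_of_le_of_ne (le_totalDegree hs) h)
  · rw [hexp, Polynomial.eval_finsetSum, eval_eq']
    refine Finset.sum_congr rfl fun s _ => ?_
    simp only [Polynomial.eval_mul, Polynomial.eval_C, Polynomial.eval_prod, Polynomial.eval_pow,
      hL, Polynomial.eval_add, Polynomial.eval_X, Pi.add_apply, Pi.smul_apply, smul_eq_mul,
      mul_comm t]

lemma norm_eval_reflect_conj {P : Polynomial ℂ} {m : ℕ} (hP : P.natDegree ≤ m) {t : ℂ}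
    (ht : ‖t‖ = 1) :
    ‖(Polynomial.reflect m (P.map (starRingEnd ℂ))).eval t‖ = ‖P.eval t‖ := by
  have ht0 : t ≠ 0 := by
    rintro rfl
    simp at ht
  let _ : Invertible t⁻¹ := invertibleOfNonzero (inv_ne_zero ht0)
  have h := Polynomial.eval₂_reflect_mul_pow (RingHom.id ℂ) t⁻¹ m (P.map (starRingEnd ℂ))
    (Polynomial.natDegree_map_le.trans hP)
  rw [invOf_eq_inv, inv_inv, Polynomial.eval₂_id, Polynomial.eval₂_id] at h
  have h1 := congrArg norm h
  rw [norm_mul, norm_pow, norm_inv, ht, inv_one, one_pow, mul_one] at h1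
  rw [h1, Complex.inv_eq_conj ht, Polynomial.eval_map_apply, RCLike.norm_conj]

/-- Division estimate: a polynomial multiple of an entire function controls the function. -/
theorem exists_norm_le_of_norm_mul_le {n : ℕ} {Q : MvPolynomial (Fin n) ℂ} (hQ : Q ≠ 0) :
    ∃ (v : Fin n → ℂ) (c : ℝ), 0 < c ∧ ∀ (g : (Fin n → ℂ) → ℂ), Differentiable ℂ g →
      ∀ (z : Fin n → ℂ) (B : ℝ),
        (∀ t : ℂ, ‖t‖ = 1 → ‖eval (z + t • v) Q * g (z + t • v)‖ ≤ B) → c * ‖g z‖ ≤ B := by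
  obtain ⟨v, m, c, hc, h⟩ := exists_direction_coeff_eq hQ
  refine ⟨v, ‖c‖, norm_pos_iff.mpr hc, fun g hg z B hB => ?_⟩
  obtain ⟨P, hdeg, hcoeff, hP⟩ := h z
  set S := Polynomial.reflect m (P.map (starRingEnd ℂ))
  have hd : Differentiable ℂ fun t : ℂ => S.eval t * g (z + t • v) :=
    S.differentiable.mul (hg.comp (by fun_prop))
  have := Complex.norm_le_of_forall_mem_frontier_norm_le (U := Metric.ball (0 : ℂ) 1)
    Metric.isBounded_ball hd.diffContOnCl (C := B) (fun t ht => ?_)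
    (subset_closure (Metric.mem_ball_self one_pos))
  · have h0 : S.eval 0 = starRingEnd ℂ c := by
      rw [← Polynomial.coeff_zero_eq_eval_zero, Polynomial.coeff_reflect]
      simp [hcoeff]
    simpa [h0] using this
  · rw [frontier_ball _ one_ne_zero, mem_sphere_zero_iff_norm] at ht
    rw [norm_mul, norm_eval_reflect_conj hdeg ht, hP, ← norm_mul]
    exact hB t ht

/-- A sequence of entire functions that is uniformly Cauchy on bounded sets converges to an
entire function. -/
theorem exists_differentiable_tendsto {n : ℕ} {g : ℕ → (Fin n → ℂ) → ℂ}
    (hg : ∀ k, Differentiable ℂ (g k))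
    (hC : ∀ R : ℝ, ∀ ε > 0, ∃ N, ∀ k ≥ N, ∀ l ≥ N, ∀ z, ‖z‖ ≤ R → ‖g k z - g l z‖ ≤ ε) :
    ∃ F : (Fin n → ℂ) → ℂ, Differentiable ℂ F ∧
      ∀ z, Filter.Tendsto (fun k => g k z) Filter.atTop (nhds (F z)) := by
  have hpt : ∀ z, ∃ y, Filter.Tendsto (fun k => g k z) Filter.atTop (nhds y) := by
    intro z
    refine cauchySeq_tendsto_of_complete (Metric.cauchySeq_iff.mpr fun ε hε => ?_)
    obtain ⟨N, hN⟩ := hC ‖z‖ (ε / 2) (half_pos hε)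
    exact ⟨N, fun k hk l hl => by
      rw [dist_eq_norm]
      exact (hN k hk l hl z le_rfl).trans_lt (half_lt_self hε)⟩
  choose F hF using hpt
  have hfd : ∀ (R : ℝ), ∀ ε > 0, ∃ N, ∀ k ≥ N, ∀ l ≥ N, ∀ z, ‖z‖ ≤ R →
      ‖fderiv ℂ (g k) z - fderiv ℂ (g l) z‖ ≤ ε := by
    intro R ε hε
    obtain ⟨N, hN⟩ := hC (R + 1) ε hε
    refine ⟨N, fun k hk l hl z hz => ?_⟩
    have hd : Differentiable ℂ (fun w => g k w - g l w) := (hg k).sub (hg l)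
    have hfs : fderiv ℂ (g k) z - fderiv ℂ (g l) z = fderiv ℂ (fun w => g k w - g l w) z :=
      (fderiv_fun_sub (hg k z) (hg l z)).symm
    rw [hfs]
    refine ContinuousLinearMap.opNorm_le_of_unit_norm (𝕜 := ℂ) hε.le fun v hv => ?_
    have hline : HasDerivAt (fun t : ℂ => z + t • v) v 0 := by
      simpa using ((hasDerivAt_id (0 : ℂ)).smul_const v).const_add z
    have hder : HasDerivAt (fun t : ℂ => g k (z + t • v) - g l (z + t • v))
        (fderiv ℂ (fun w => g k w - g l w) z v) 0 := by
      have h1 : HasFDerivAt (fun w => g k w - g l w) (fderiv ℂ (fun w => g k w - g l w) z)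
          (z + (0 : ℂ) • v) := by
        simpa using (hd z).hasFDerivAt
      exact h1.comp_hasDerivAt (0 : ℂ) hline
    rw [← hder.deriv]
    have hline' : Differentiable ℂ (fun t : ℂ => z + t • v) := by fun_prop
    have := Complex.norm_deriv_le_of_forall_mem_sphere_norm_le (c := 0) (R := 1) (C := ε)
      (f := fun t : ℂ => g k (z + t • v) - g l (z + t • v)) one_pos
      (hd.comp hline').diffContOnCl (fun t ht => hN k hk l hl _ ?_)
    · simpa using this
    · refine (norm_add_le _ _).trans (add_le_add hz ?_)
      rw [norm_smul, hv, mem_sphere_zero_iff_norm.mp ht, one_mul]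
  have hfpt : ∀ z, ∃ y, Filter.Tendsto (fun k => fderiv ℂ (g k) z) Filter.atTop (nhds y) := by
    intro z
    refine cauchySeq_tendsto_of_complete (Metric.cauchySeq_iff.mpr fun ε hε => ?_)
    obtain ⟨N, hN⟩ := hfd ‖z‖ (ε / 2) (half_pos hε)
    exact ⟨N, fun k hk l hl => by
      rw [dist_eq_norm]
      exact (hN k hk l hl z le_rfl).trans_lt (half_lt_self hε)⟩
  choose F' hF' using hfpt
  refine ⟨F, fun z => ?_, hF⟩
  have hunif : TendstoUniformlyOn (fun k => fderiv ℂ (g k)) F' Filter.atTop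
      (Metric.ball 0 (‖z‖ + 1)) := by
    refine UniformCauchySeqOn.tendstoUniformlyOn_of_tendsto ?_ fun w _ => hF' w
    refine Metric.uniformCauchySeqOn_iff.mpr fun ε hε => ?_
    obtain ⟨N, hN⟩ := hfd (‖z‖ + 1) (ε / 2) (half_pos hε)
    refine ⟨N, fun k hk l hl w hw => ?_⟩
    rw [dist_eq_norm]
    exact (hN k hk l hl w (mem_ball_zero_iff.mp hw).le).trans_lt (half_lt_self hε)
  exact (hasFDerivAt_of_tendstoUniformlyOn Metric.isOpen_ball hunif
    (fun k w _ => (hg k w).hasFDerivAt) (fun w _ => hF w) (by simp)).differentiableAt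

lemma gAct_one {n : ℕ} (z : Fin n → ℂ) : gAct 1 z = z := by
  simp [gAct]

lemma gAct_mul {n : ℕ} (σ τ : GL (Fin n) ℂ) (z : Fin n → ℂ) :
    gAct (σ * τ) z = gAct σ (gAct τ z) := by
  simp [gAct, Matrix.mulVec_mulVec]

lemma continuous_gAct {n : ℕ} (σ : GL (Fin n) ℂ) : Continuous (gAct σ) :=
  continuous_const.matrix_mulVec continuous_id

/-- `polyAct σ` as an algebra homomorphism. -/
def polyActHom {n : ℕ} (σ : GL (Fin n) ℂ) :
    MvPolynomial (Fin n) ℂ →ₐ[ℂ] MvPolynomial (Fin n) ℂ :=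
  MvPolynomial.aeval
    (fun i => ∑ j, MvPolynomial.C (((σ⁻¹ : GL (Fin n) ℂ) : Matrix (Fin n) (Fin n) ℂ) i j)
      * MvPolynomial.X j)

lemma polyAct_eq_polyActHom {n : ℕ} (σ : GL (Fin n) ℂ) (q : MvPolynomial (Fin n) ℂ) :
    polyAct σ q = polyActHom σ q := rfl

lemma eval_polyActHom {n : ℕ} (σ : GL (Fin n) ℂ) (q : MvPolynomial (Fin n) ℂ) (z : Fin n → ℂ) :
    eval z (polyActHom σ q) = eval (gAct σ⁻¹ z) q := by
  induction q using MvPolynomial.induction_on with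
  | C a => simp [polyActHom]
  | add a b ha hb => simp [ha, hb]
  | mul_X a i ha =>
    rw [map_mul, map_mul, map_mul, ha]
    congr 1
    simp [polyActHom, gAct, Matrix.mulVec, dotProduct]

lemma polyActHom_one {n : ℕ} (q : MvPolynomial (Fin n) ℂ) : polyActHom 1 q = q :=
  MvPolynomial.funext fun z => by rw [eval_polyActHom, inv_one, gAct_one]

lemma polyActHom_mul {n : ℕ} (σ τ : GL (Fin n) ℂ) (q : MvPolynomial (Fin n) ℂ) :
    polyActHom (σ * τ) q = polyActHom σ (polyActHom τ q) :=
  MvPolynomial.funext fun z => by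
    rw [eval_polyActHom, eval_polyActHom, eval_polyActHom, mul_inv_rev, gAct_mul]

lemma polyActHom_injective {n : ℕ} :
    Function.Injective (polyActHom : GL (Fin n) ℂ → _) := by
  intro σ τ h
  rw [← inv_inj]
  refine Units.ext (Matrix.ext_iff_mulVec.mpr fun z => funext fun i => ?_)
  have := congrArg (eval z) (DFunLike.congr_fun h (X i))
  rwa [eval_polyActHom, eval_polyActHom, eval_X, eval_X] at this

lemma eval_gAct_of_polyAct_eq {n : ℕ} {G : Subgroup (GL (Fin n) ℂ)}
    {q : MvPolynomial (Fin n) ℂ} (hq : ∀ σ ∈ G, polyAct σ q = q) {σ : GL (Fin n) ℂ} (hσ : σ ∈ G)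
    (z : Fin n → ℂ) : eval (gAct σ z) q = eval z q := by
  conv_rhs => rw [← hq σ⁻¹ (inv_mem hσ)]
  rw [polyAct_eq_polyActHom, eval_polyActHom, inv_inv]

/-- Independence over the invariant ring of as many polynomials as there are group elements makes
the matrix of their translates nonsingular. -/
theorem det_polyAct_ne_zero {n : ℕ} {G : Subgroup (GL (Fin n) ℂ)} [Finite G] {d : ℕ}
    (e : Fin d ≃ G) {p : Fin d → MvPolynomial (Fin n) ℂ}
    (hp : ∀ r r' : Fin d → MvPolynomial (Fin n) ℂ,
      (∀ i, ∀ σ ∈ G, polyAct σ (r i) = r i) → (∀ i, ∀ σ ∈ G, polyAct σ (r' i) = r' i) →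
      ∑ i, r i * p i = ∑ i, r' i * p i → r = r') :
    (Matrix.of fun j i => polyAct (e j : GL (Fin n) ℂ) (p i)).det ≠ 0 := by
  have := Fintype.ofFinite G
  rw [Ne, ← Matrix.exists_mulVec_eq_zero_iff]
  rintro ⟨v, hv, hMv⟩
  refine hv (funext fun i => ?_)
  have hrow : ∀ σ : G, ∑ i, polyActHom (σ : GL (Fin n) ℂ) (p i) * v i = 0 := by
    intro σ
    simpa [Matrix.mulVec, dotProduct, polyAct_eq_polyActHom] using congrFun hMv (e.symm σ)
  have htrace : ∀ b i, ∑ τ : G, polyActHom (τ : GL (Fin n) ℂ) (b * v i) = 0 := by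
    intro b i
    refine congrFun (hp (fun i => ∑ τ : G, polyActHom (τ : GL (Fin n) ℂ) (b * v i)) 0 ?_ ?_ ?_) i
    · intro i σ hσ
      rw [polyAct_eq_polyActHom, map_sum]
      simp only [← polyActHom_mul]
      exact Fintype.sum_equiv (Equiv.mulLeft (⟨σ, hσ⟩ : G)) _ _ fun τ => rfl
    · intro i σ _
      rw [polyAct_eq_polyActHom, Pi.zero_apply, map_zero]
    · simp only [Finset.sum_mul, Pi.zero_apply, zero_mul, Finset.sum_const_zero]
      rw [Finset.sum_comm]
      refine Finset.sum_eq_zero fun τ _ => ?_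
      have h1 := congrArg (polyActHom (τ : GL (Fin n) ℂ)) (hrow τ⁻¹)
      simp only [map_sum, map_mul, map_zero, ← polyActHom_mul, InvMemClass.coe_inv,
        mul_inv_cancel, polyActHom_one] at h1
      simp only [map_mul]
      calc _ = polyActHom (τ : GL (Fin n) ℂ) b *
            ∑ i, p i * polyActHom (τ : GL (Fin n) ℂ) (v i) := by
            rw [Finset.mul_sum]
            exact Finset.sum_congr rfl fun _ _ => by ring
        _ = 0 := by rw [h1, mul_zero]
  have hli := (linearIndependent_monoidHom (MvPolynomial (Fin n) ℂ) (MvPolynomial (Fin n) ℂ)).comp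
    (fun τ : G => ((polyActHom (τ : GL (Fin n) ℂ) : _ →ₐ[ℂ] _) : _ →* _)) (by
      intro σ τ h
      exact Subtype.ext (polyActHom_injective (AlgHom.ext fun q => DFunLike.congr_fun h q)))
  have hzero := Fintype.linearIndependent_iff.mp hli
    (fun τ => polyActHom (τ : GL (Fin n) ℂ) (v i)) (funext fun b => by
      have := htrace b i
      simp only [map_mul] at this
      simpa [mul_comm] using this) 1
  simpa [polyActHom_one] using hzero

/-- Invariant coefficients are controlled by the combination they define. -/
theorem exists_norm_coeff_le {n : ℕ} {G : Subgroup (GL (Fin n) ℂ)} [Finite G] {d : ℕ}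
    (hd : d = Nat.card G) {p : Fin d → MvPolynomial (Fin n) ℂ}
    (hp : ∀ r r' : Fin d → MvPolynomial (Fin n) ℂ,
      (∀ i, ∀ σ ∈ G, polyAct σ (r i) = r i) → (∀ i, ∀ σ ∈ G, polyAct σ (r' i) = r' i) →
      ∑ i, r i * p i = ∑ i, r' i * p i → r = r') (R : ℝ) :
    ∃ A R' : ℝ, 0 ≤ A ∧ ∀ F : Fin d → (Fin n → ℂ) → ℂ,
      (∀ i, Differentiable ℂ (F i) ∧ ∀ σ ∈ G, ∀ z : Fin n → ℂ, F i (gAct σ z) = F i z) →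
      ∀ B : ℝ, 0 ≤ B → (∀ w, ‖w‖ ≤ R' → ‖∑ i, eval w (p i) * F i w‖ ≤ B) →
        ∀ i z, ‖z‖ ≤ R → ‖F i z‖ ≤ A * B := by
  have e : Fin d ≃ G := (finCongr hd).trans (Finite.equivFin G).symm
  set M : Matrix (Fin d) (Fin d) (MvPolynomial (Fin n) ℂ) :=
    Matrix.of fun j i => polyAct (e j : GL (Fin n) ℂ) (p i) with hM
  obtain ⟨v, c, hc, hdiv⟩ := exists_norm_le_of_norm_mul_le (det_polyAct_ne_zero e hp)
  obtain ⟨R', hR'⟩ := (isCompact_closedBall (0 : Fin n → ℂ) (R + ‖v‖)).exists_bound_of_continuousOn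
    (f := fun z => ∑ j, ‖gAct (e j : GL (Fin n) ℂ)⁻¹ z‖)
    (continuous_finsetSum _ fun j _ => (continuous_gAct _).norm).continuousOn
  obtain ⟨K, hK⟩ := (isCompact_closedBall (0 : Fin n → ℂ) (R + ‖v‖)).exists_bound_of_continuousOn
    (f := fun z => ∑ i, ∑ j, ‖eval z (M.adjugate i j)‖)
    (continuous_finsetSum _ fun i _ => continuous_finsetSum _ fun j _ =>
      (MvPolynomial.continuous_eval _).norm).continuousOn
  refine ⟨c⁻¹ * |K|, R', by positivity, fun F hF B hB0 hB i z hz => ?_⟩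
  rw [mul_assoc, ← inv_mul_le_iff₀ (inv_pos.mpr hc), inv_inv]
  refine hdiv (F i) (hF i).1 z (|K| * B) fun t ht => ?_
  have hy : ‖z + t • v‖ ≤ R + ‖v‖ := by
    refine (norm_add_le _ _).trans (add_le_add hz ?_)
    rw [norm_smul, ht, one_mul]
  set y := z + t • v
  have hy' : y ∈ Metric.closedBall (0 : Fin n → ℂ) (R + ‖v‖) := mem_closedBall_zero_iff.mpr hy
  set H : (Fin n → ℂ) → ℂ := fun w => ∑ i, eval w (p i) * F i w with hH
  have hrow : ∀ j, ∑ k, eval y (M j k) * F k y = H (gAct (e j : GL (Fin n) ℂ)⁻¹ y) := by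
    intro j
    refine Finset.sum_congr rfl fun k _ => ?_
    rw [(hF k).2 _ (inv_mem (e j).2), hM, Matrix.of_apply, polyAct_eq_polyActHom, eval_polyActHom]
  have hcramer : eval y M.det * F i y =
      ∑ j, eval y (M.adjugate i j) * H (gAct (e j : GL (Fin n) ℂ)⁻¹ y) := by
    have hadj := congrFun (congrArg (fun N => Matrix.mulVec N fun k => F k y)
      (congrArg (fun N => N.map (eval y)) M.adjugate_mul)) i
    simp only [Matrix.map_mul, ← Matrix.mulVec_mulVec] at hadj
    simp only [← hrow]
    simp only [Matrix.mulVec, dotProduct, Matrix.map_apply, Matrix.smul_apply, Matrix.one_apply,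
      smul_eq_mul, mul_one, mul_zero, apply_ite, map_zero, ite_mul, zero_mul,
      Finset.sum_ite_eq, Finset.mem_univ, if_true] at hadj
    exact hadj.symm
  rw [hcramer]
  calc _ ≤ ∑ j, ‖eval y (M.adjugate i j)‖ * B := by
        refine norm_sum_le_of_le _ fun j _ => ?_
        rw [norm_mul]
        refine mul_le_mul_of_nonneg_left (hB _ ?_) (norm_nonneg _)
        exact (Finset.single_le_sum (f := fun j => ‖gAct (e j : GL (Fin n) ℂ)⁻¹ y‖)
          (fun _ _ => norm_nonneg _) (Finset.mem_univ j)).trans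
          ((le_abs_self _).trans (hR' y hy'))
    _ ≤ _ := by
        rw [← Finset.sum_mul]
        refine mul_le_mul_of_nonneg_right ?_ hB0
        exact (Finset.single_le_sum (f := fun i => ∑ j, ‖eval y (M.adjugate i j)‖)
          (fun _ _ => Finset.sum_nonneg fun _ _ => norm_nonneg _) (Finset.mem_univ i)).trans
          ((le_abs_self _).trans ((hK y hy').trans (le_abs_self K)))

lemma differentiable_eval {n : ℕ} (q : MvPolynomial (Fin n) ℂ) :
    Differentiable ℂ fun z : Fin n → ℂ => eval z q := by
  induction q using MvPolynomial.induction_on with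
  | C a => simp
  | add a b ha hb =>
    simp only [map_add]
    exact ha.add hb
  | mul_X a i ha =>
    simp only [map_mul, eval_X]
    exact ha.mul (differentiable_apply i)

/-- **Analytic Chevalley–Shephard–Todd theorem (free module form).**
If `p₁,…,p_d` (`d = |G|`) is a basis of `ℂ[z]` over `ℂ[z]^G` for a finite pseudoreflection
group `G`, then every entire function `f : ℂⁿ → ℂ` has a unique decomposition
`f = Σᵢ pᵢ fᵢ` with each `fᵢ` a `G`-invariant entire function. -/
theorem analytic_CST_free_module {n : ℕ} (G : Subgroup (GL (Fin n) ℂ)) [Finite G]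
    (hG : IsPseudoreflectionGroup G) (d : ℕ) (hd : d = Nat.card G)
    (p : Fin d → MvPolynomial (Fin n) ℂ)
    (hbasis_ex : ∀ q : MvPolynomial (Fin n) ℂ, ∃ r : Fin d → MvPolynomial (Fin n) ℂ,
      (∀ i, ∀ σ ∈ G, polyAct σ (r i) = r i) ∧ q = ∑ i, r i * p i)
    (hbasis_uniq : ∀ r r' : Fin d → MvPolynomial (Fin n) ℂ,
      (∀ i, ∀ σ ∈ G, polyAct σ (r i) = r i) → (∀ i, ∀ σ ∈ G, polyAct σ (r' i) = r' i) →
      ∑ i, r i * p i = ∑ i, r' i * p i → r = r')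
    (f : (Fin n → ℂ) → ℂ) (hf : Differentiable ℂ f) :
    ∃! F : Fin d → (Fin n → ℂ) → ℂ,
      (∀ i, Differentiable ℂ (F i) ∧ ∀ σ ∈ G, ∀ z : Fin n → ℂ, F i (gAct σ z) = F i z) ∧
      ∀ z : Fin n → ℂ, f z = ∑ i, MvPolynomial.eval z (p i) * F i z := by
  have hinv : ∀ q : MvPolynomial (Fin n) ℂ, (∀ σ ∈ G, polyAct σ q = q) →
      Differentiable ℂ (fun z : Fin n → ℂ => eval z q) ∧
        ∀ σ ∈ G, ∀ z : Fin n → ℂ, eval (gAct σ z) q = eval z q :=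
    fun q hq => ⟨differentiable_eval q, fun σ hσ => eval_gAct_of_polyAct_eq hq hσ⟩
  have hsub : ∀ F F' : Fin d → (Fin n → ℂ) → ℂ,
      (∀ i, Differentiable ℂ (F i) ∧ ∀ σ ∈ G, ∀ z : Fin n → ℂ, F i (gAct σ z) = F i z) →
      (∀ i, Differentiable ℂ (F' i) ∧ ∀ σ ∈ G, ∀ z : Fin n → ℂ, F' i (gAct σ z) = F' i z) →
      ∀ i, Differentiable ℂ (fun z => F i z - F' i z) ∧ ∀ σ ∈ G, ∀ z : Fin n → ℂ,
        F i (gAct σ z) - F' i (gAct σ z) = F i z - F' i z :=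
    fun F F' h h' i => ⟨(h i).1.sub (h' i).1, fun σ hσ z => by
      rw [(h i).2 σ hσ, (h' i).2 σ hσ]⟩
  have hq : ∀ k : ℕ, ∃ q : MvPolynomial (Fin n) ℂ, ∀ z : Fin n → ℂ, ‖z‖ ≤ (k : ℝ) + 1 →
      ‖f z - eval z q‖ ≤ 1 / ((k : ℝ) + 1) :=
    fun k => exists_mvPolynomial_near hf (by positivity) (by positivity)
  choose q hq using hq
  choose r hrinv hr using fun k => hbasis_ex (q k)
  have hreval : ∀ k z, eval z (q k) = ∑ i, eval z (p i) * eval z (r k i) := by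
    intro k z
    conv_lhs => rw [hr k]
    simp [mul_comm]
  have hqlim : ∀ ρ : ℝ, ∀ η > 0, ∃ N : ℕ, ∀ k ≥ N, ∀ z : Fin n → ℂ, ‖z‖ ≤ ρ →
      ‖f z - eval z (q k)‖ ≤ η := by
    intro ρ η hη
    obtain ⟨N₁, hN₁⟩ := exists_nat_ge ρ
    obtain ⟨N₂, hN₂⟩ := exists_nat_one_div_lt hη
    refine ⟨max N₁ N₂, fun k hk z hz => ?_⟩
    have h1 : (N₁ : ℝ) ≤ k := by exact_mod_cast (le_max_left _ _).trans hk
    have h2 : (N₂ : ℝ) ≤ k := by exact_mod_cast (le_max_right _ _).trans hk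
    refine (hq k z (by linarith)).trans (le_trans ?_ hN₂.le)
    gcongr
  have hcauchy : ∀ i, ∀ R : ℝ, ∀ ε > 0, ∃ N, ∀ k ≥ N, ∀ l ≥ N, ∀ z : Fin n → ℂ, ‖z‖ ≤ R →
      ‖eval z (r k i) - eval z (r l i)‖ ≤ ε := by
    intro i R ε hε
    obtain ⟨A, R', hA, hbound⟩ := exists_norm_coeff_le hd hbasis_uniq R
    obtain ⟨N, hN⟩ := hqlim R' (ε / (2 * (A + 1))) (by positivity)
    refine ⟨N, fun k hk l hl z hz => ?_⟩
    have := hbound (fun i z => eval z (r k i) - eval z (r l i))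
      (hsub (fun i z => eval z (r k i)) (fun i z => eval z (r l i))
        (fun i => hinv _ (hrinv k i)) (fun i => hinv _ (hrinv l i)))
      (ε / (A + 1)) (by positivity) (fun w hw => ?_) i z hz
    · refine this.trans ?_
      rw [mul_div_assoc', div_le_iff₀ (by positivity)]
      nlinarith
    · have hk' := hN k hk w hw
      have hl' := hN l hl w hw
      simp only [mul_sub, Finset.sum_sub_distrib, ← hreval]
      calc ‖eval w (q k) - eval w (q l)‖
          = ‖(f w - eval w (q l)) - (f w - eval w (q k))‖ := by congr 1; ring
        _ ≤ _ := (norm_sub_le _ _).trans (add_le_add hl' hk')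
        _ = _ := by field_simp; ring
  choose F hFd hF using fun i =>
    exists_differentiable_tendsto (fun k => differentiable_eval (r k i)) (hcauchy i)
  have hFinv : ∀ i, Differentiable ℂ (F i) ∧
      ∀ σ ∈ G, ∀ z : Fin n → ℂ, F i (gAct σ z) = F i z := by
    refine fun i => ⟨hFd i, fun σ hσ z => tendsto_nhds_unique (hF i (gAct σ z)) ?_⟩
    simp only [eval_gAct_of_polyAct_eq (hrinv _ i) hσ]
    exact hF i z
  have hFsum : ∀ z, f z = ∑ i, eval z (p i) * F i z := by
    intro z
    have h1 : Filter.Tendsto (fun k => eval z (q k)) Filter.atTop (nhds (f z)) := by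
      rw [Metric.tendsto_atTop]
      intro ε hε
      obtain ⟨N, hN⟩ := hqlim ‖z‖ (ε / 2) (half_pos hε)
      refine ⟨N, fun k hk => ?_⟩
      rw [dist_comm, dist_eq_norm]
      exact (hN k hk z le_rfl).trans_lt (half_lt_self hε)
    simp only [hreval] at h1
    exact tendsto_nhds_unique h1 (tendsto_finsetSum _ fun i _ => (hF i z).const_mul _)
  refine ⟨F, ⟨hFinv, hFsum⟩, fun F' ⟨hF', hF'sum⟩ => ?_⟩
  funext i z
  obtain ⟨A, R', hA, hbound⟩ := exists_norm_coeff_le hd hbasis_uniq ‖z‖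
  have := hbound (fun i z => F' i z - F i z) (hsub F' F hF' hFinv) 0 le_rfl (fun w _ => ?_) i z
    le_rfl
  · rw [mul_zero, norm_le_zero_iff] at this
    exact sub_eq_zero.mp this
  · simp only [mul_sub, Finset.sum_sub_distrib, ← hF'sum, ← hFsum, sub_self, norm_zero, le_refl]
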